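/- Suppose f_A(s, ·) : ℝ → ℝ is strictly increasing and continuous for each s ∈ 𝒮, and A = f_A(S, U_A) with U_A having a strictly increasing continuous CDF and independent of S. Then for each s, the conditional CDF of A given S = s evaluated at f_A(s, u) equals P(U_A ≤ u), and consequently F_{s'}⁻¹(F_{s}(f_A(s, u))) = f_A(s', u) for all s, s' ∈ 𝒮 and all u; i.e., the marginal distribution mapping transports f_A(s, u) to f_A(s', u). -/

import Mathlib

open MeasureTheory ProbabilityTheory

/-- With `A = f_A(S, U_A)`, each `f_A(s,·)` strictly increasing continuous with full range,
`U_A` independent of `S` with strictly increasing continuous CDF: the conditional CDF of `A`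
given `S = s` evaluated at `f_A(s,u)` equals `P(U_A ≤ u)`, and the marginal distribution
mapping transports `f_A(s,u)` to `f_A(s',u)`: `F_{s'}⁻¹(F_s(f_A(s,u))) = f_A(s',u)`. -/
theorem stmt_6 {Ω : Type*} [MeasurableSpace Ω]
    (μ : Measure Ω) [IsProbabilityMeasure μ]
    {𝒮 : Type*} [Fintype 𝒮] [MeasurableSpace 𝒮] [MeasurableSingletonClass 𝒮]
    (S : Ω → 𝒮) (UA : Ω → ℝ) (hSm : Measurable S) (hUAm : Measurable UA)
    (hindep : IndepFun S UA μ)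
    (hpos : ∀ s : 𝒮, μ {ω | S ω = s} ≠ 0)
    (Φ : ℝ → ℝ) (hΦdef : ∀ u, (μ {ω | UA ω ≤ u}).toReal = Φ u)
    (hΦm : StrictMono Φ) (hΦc : Continuous Φ)
    (f : 𝒮 → ℝ → ℝ)
    (hfm : ∀ s, StrictMono (f s)) (hfc : ∀ s, Continuous (f s))
    (hfr : ∀ s, Set.range (f s) = Set.univ) :
    let A : Ω → ℝ := fun ω => f (S ω) (UA ω)
    let F : 𝒮 → ℝ → ℝ := fun s x =>
      (μ {ω | A ω ≤ x ∧ S ω = s}).toReal / (μ {ω | S ω = s}).toReal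
    let Finv : 𝒮 → ℝ → ℝ := fun s z => sInf {x : ℝ | z ≤ F s x}
    ∀ (s s' : 𝒮) (u : ℝ),
      F s (f s u) = (μ {ω | UA ω ≤ u}).toReal ∧ Finv s' (F s (f s u)) = f s' u := by
  intro A F Finv
  have key : ∀ (s : 𝒮) (u : ℝ), F s (f s u) = (μ {ω | UA ω ≤ u}).toReal := by
    intro s u
    have hset : {ω | A ω ≤ f s u ∧ S ω = s} = S ⁻¹' {s} ∩ UA ⁻¹' (Set.Iic u) := by
      ext ω
      simp only [A, Set.mem_setOf_eq, Set.mem_inter_iff, Set.mem_preimage, Set.mem_singleton_iff,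
        Set.mem_Iic]
      constructor
      · rintro ⟨h1, h2⟩
        rw [h2] at h1
        exact ⟨h2, (hfm s).le_iff_le.mp h1⟩
      · rintro ⟨h1, h2⟩
        refine ⟨?_, h1⟩
        rw [h1]
        exact (hfm s).monotone h2
    have hprod := hindep.measure_inter_preimage_eq_mul {s} (Set.Iic u)
      (measurableSet_singleton s) measurableSet_Iic
    have hne : (μ {ω | S ω = s}).toReal ≠ 0 :=
      ENNReal.toReal_ne_zero.mpr ⟨hpos s, measure_ne_top _ _⟩
    change (μ {ω | A ω ≤ f s u ∧ S ω = s}).toReal / (μ {ω | S ω = s}).toReal = _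
    rw [hset, hprod, ENNReal.toReal_mul]
    change (μ {ω | S ω = s}).toReal * (μ {ω | UA ω ≤ u}).toReal / _ = _
    exact mul_div_cancel_left₀ _ hne
  intro s s' u
  refine ⟨key s u, ?_⟩
  have hset : {x : ℝ | F s (f s u) ≤ F s' x} = Set.Ici (f s' u) := by
    ext x
    obtain ⟨v, rfl⟩ : x ∈ Set.range (f s') := by rw [hfr s']; trivial
    rw [Set.mem_setOf_eq, key, key, hΦdef, hΦdef, hΦm.le_iff_le, Set.mem_Ici,
      (hfm s').le_iff_le]
  change sInf {x : ℝ | F s (f s u) ≤ F s' x} = _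
  rw [hset, csInf_Ici]
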